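/- For complex numbers a, c, b₁, b₂ such that c, 1−a−b₂, and relevant lower parameters are not nonpositive integers, and for real x, y with |x|, |y| sufficiently small, the identity F₁(a; b₁, b₂; c; x, y) = (y/x)^{−b₂} F₂(b₁+b₂; a, b₂; c, b₁+b₂; x, 1−x/y) holds whenever both double series converge absolutely (with x, y ≠ 0 and |1−x/y| < 1). -/

import Mathlib

/-- The Pochhammer symbol `(a)_n = a(a+1)⋯(a+n-1)`. -/
noncomputable def poch (a : ℂ) (n : ℕ) : ℂ := Polynomial.eval a (ascPochhammer ℂ n)

/-- `z` is not a nonpositive integer. -/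
def NotNonposInt (z : ℂ) : Prop := ∀ m : ℕ, z ≠ -(m : ℂ)

/-- The summand of the Appell `F₁` double series. -/
noncomputable def F1term (a b₁ b₂ c : ℂ) (x y : ℂ) (p : ℕ × ℕ) : ℂ :=
  poch a (p.1 + p.2) / poch c (p.1 + p.2) *
    (poch b₁ p.1 * poch b₂ p.2) / ((Nat.factorial p.1) * (Nat.factorial p.2)) *
    x ^ p.1 * y ^ p.2

/-- Appell's first function `F₁(a; b₁, b₂; c; x, y)`. -/
noncomputable def F1 (a b₁ b₂ c : ℂ) (x y : ℂ) : ℂ := ∑' p : ℕ × ℕ, F1term a b₁ b₂ c x y p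

/-- The summand of the Appell `F₂` double series. -/
noncomputable def F2term (a b₁ b₂ c₁ c₂ : ℂ) (x y : ℂ) (p : ℕ × ℕ) : ℂ :=
  poch a (p.1 + p.2) * poch b₁ p.1 * poch b₂ p.2 /
    (poch c₁ p.1 * poch c₂ p.2 * (Nat.factorial p.1) * (Nat.factorial p.2)) *
    x ^ p.1 * y ^ p.2

/-- Appell's second function `F₂(a; b₁, b₂; c₁, c₂; x, y)`. -/
noncomputable def F2 (a b₁ b₂ c₁ c₂ : ℂ) (x y : ℂ) : ℂ := ∑' p : ℕ × ℕ, F2term a b₁ b₂ c₁ c₂ x y p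

theorem multichoose_eq_poch_div (r : ℂ) (n : ℕ) :
    Ring.multichoose r n = poch r n / (n.factorial : ℂ) := by
  have h := Ring.factorial_nsmul_multichoose_eq_ascPochhammer r n
  rw [Polynomial.ascPochhammer_smeval_eq_eval, nsmul_eq_mul] at h
  rw [poch, ← h, mul_div_cancel_left₀ _ (Nat.cast_ne_zero.mpr n.factorial_ne_zero)]

theorem multichoose_eq_neg_one_pow_mul_choose_neg (r : ℂ) (n : ℕ) :
    Ring.multichoose r n = (-1) ^ n * Ring.choose (-r) n := by
  have h : ((Int.negOnePow (n : ℤ) : ℤˣ) : ℤ) = (-1) ^ n := by simp [Int.negOnePow]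
  rw [Ring.choose_neg', Units.smul_def, h, zsmul_eq_mul, ← mul_assoc]
  push_cast
  rw [← mul_pow]
  simp

theorem multichoose_add (r s : ℂ) (n : ℕ) :
    Ring.multichoose (r + s) n =
      ∑ p ∈ Finset.HasAntidiagonal.antidiagonal n,
        Ring.multichoose r p.1 * Ring.multichoose s p.2 := by
  rw [multichoose_eq_neg_one_pow_mul_choose_neg, neg_add,
    Ring.add_choose_eq n (Commute.all _ _), Finset.mul_sum]
  refine Finset.sum_congr rfl fun p hp => ?_
  rw [multichoose_eq_neg_one_pow_mul_choose_neg r, multichoose_eq_neg_one_pow_mul_choose_neg s,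
    ← Finset.HasAntidiagonal.mem_antidiagonal.mp hp, pow_add]
  ring

theorem poch_add (r : ℂ) (m n : ℕ) : poch r (m + n) = poch r m * poch (r + m) n := by
  simp [poch, ← ascPochhammer_mul]

theorem poch_ne_zero {r : ℂ} (hr : NotNonposInt r) (n : ℕ) : poch r n ≠ 0 := by
  rw [poch, Ne, ascPochhammer_eval_eq_zero_iff]
  rintro ⟨k, -, hk⟩
  exact hr k (by rw [hk, neg_neg])

theorem hasSum_multichoose_mul_pow (r : ℂ) {z : ℂ} (hz : ‖z‖ < 1) :
    HasSum (fun k : ℕ => Ring.multichoose r k * z ^ k) ((1 - z) ^ (-r)) := by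
  have h := (Complex.one_div_one_sub_cpow_hasFPowerSeriesOnBall_zero r).hasSum (y := z)
    (by simpa [Metric.mem_eball, edist_zero_right, ← ofReal_norm] using hz)
  simpa [Ring.multichoose_eq, Complex.cpow_neg, FormalMultilinearSeries.ofScalars_apply_eq,
    mul_comm] using h

theorem F2term_eq_sum (a c b₁ b₂ : ℂ) (hb : NotNonposInt (b₁ + b₂)) (x z : ℂ) (m k : ℕ) :
    F2term (b₁ + b₂) a b₂ c (b₁ + b₂) x z (m, k) =
      poch a m / poch c m * x ^ m * ∑ p ∈ Finset.HasAntidiagonal.antidiagonal m,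
        Ring.multichoose b₁ p.1 * Ring.multichoose b₂ p.2 *
          (Ring.multichoose (b₂ + p.2) k * z ^ k) := by
  have hterm (p : ℕ × ℕ) :
      Ring.multichoose b₁ p.1 * Ring.multichoose b₂ p.2 *
          (Ring.multichoose (b₂ + p.2) k * z ^ k) =
        Ring.multichoose b₁ p.1 * Ring.multichoose (b₂ + k) p.2 *
          (Ring.multichoose b₂ k * z ^ k) := by
    have h : poch b₂ p.2 * poch (b₂ + p.2) k = poch b₂ k * poch (b₂ + k) p.2 := by
      rw [← poch_add, ← poch_add, add_comm]
    simp only [multichoose_eq_poch_div]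
    linear_combination poch b₁ p.1 / (p.1.factorial : ℂ) / (p.2.factorial : ℂ) /
      (k.factorial : ℂ) * z ^ k * h
  simp_rw [hterm]
  rw [← Finset.sum_mul, ← multichoose_add, multichoose_eq_poch_div, multichoose_eq_poch_div,
    F2term, add_comm m k, poch_add, ← add_assoc]
  have := poch_ne_zero hb k
  field_simp

theorem hasSum_F2term_right (a c b₁ b₂ : ℂ) (hb : NotNonposInt (b₁ + b₂)) (x : ℂ) {z : ℂ}
    (hz : ‖z‖ < 1) (m : ℕ) :
    HasSum (fun k : ℕ => F2term (b₁ + b₂) a b₂ c (b₁ + b₂) x z (m, k))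
      (poch a m / poch c m * x ^ m * ∑ p ∈ Finset.HasAntidiagonal.antidiagonal m,
        Ring.multichoose b₁ p.1 * Ring.multichoose b₂ p.2 * (1 - z) ^ (-(b₂ + p.2))) := by
  simp_rw [F2term_eq_sum a c b₁ b₂ hb]
  exact (hasSum_sum fun p _ => (hasSum_multichoose_mul_pow (b₂ + p.2) hz).mul_left _).mul_left _

theorem F1_eq_tsum_antidiagonal {a b₁ b₂ c x y : ℂ}
    (h : Summable (F1term a b₁ b₂ c x y)) :
    F1 a b₁ b₂ c x y =
      ∑' m : ℕ, ∑ p ∈ Finset.HasAntidiagonal.antidiagonal m, F1term a b₁ b₂ c x y p := by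
  let e := Finset.HasAntidiagonal.sigmaAntidiagonalEquivProd (A := ℕ)
  have hs : Summable fun q => F1term a b₁ b₂ c x y (e q) := e.summable_iff.mpr h
  rw [F1, ← e.tsum_eq, hs.tsum_sigma' fun m => (hasSum_fintype _).summable]
  refine tsum_congr fun m => ?_
  rw [tsum_fintype]
  exact Finset.sum_coe_sort (Finset.HasAntidiagonal.antidiagonal m) (F1term a b₁ b₂ c x y)

theorem F1_to_F2 (a c b₁ b₂ : ℂ) (hc : NotNonposInt c) (hb : NotNonposInt (b₁ + b₂))
    (x y : ℝ) (hx : x ≠ 0) (hy : y ≠ 0) (hxy : |1 - x / y| < 1)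
    (h1 : Summable (fun p : ℕ × ℕ => ‖F1term a b₁ b₂ c (x : ℂ) (y : ℂ) p‖))
    (h2 : Summable (fun p : ℕ × ℕ =>
      ‖F2term (b₁ + b₂) a b₂ c (b₁ + b₂) (x : ℂ) (1 - (x : ℂ) / (y : ℂ)) p‖)) :
    F1 a b₁ b₂ c (x : ℂ) (y : ℂ) =
      ((y : ℂ) / (x : ℂ)) ^ (-b₂) *
        F2 (b₁ + b₂) a b₂ c (b₁ + b₂) (x : ℂ) (1 - (x : ℂ) / (y : ℂ)) := by
  have ht : 0 < x / y := by linarith [(abs_lt.mp hxy).2]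
  have hxC : (x : ℂ) ≠ 0 := Complex.ofReal_ne_zero.mpr hx
  have hyC : (y : ℂ) ≠ 0 := Complex.ofReal_ne_zero.mpr hy
  have htC : (x : ℂ) / y ≠ 0 := div_ne_zero hxC hyC
  have hz : ‖1 - (x : ℂ) / (y : ℂ)‖ < 1 := by
    rwa [← Complex.ofReal_div, ← Complex.ofReal_one, ← Complex.ofReal_sub, Complex.norm_real,
      Real.norm_eq_abs]
  have hinv : ((y : ℂ) / x) ^ (-b₂) * ((x : ℂ) / y) ^ (-b₂) = 1 := by
    have harg : ((x : ℂ) / y).arg ≠ Real.pi := by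
      rw [← Complex.ofReal_div, Complex.arg_ofReal_of_nonneg ht.le]
      exact Real.pi_ne_zero.symm
    rw [← inv_div, Complex.inv_cpow _ _ harg, inv_mul_cancel₀]
    simp [Complex.cpow_eq_zero_iff, htC]
  rw [F1_eq_tsum_antidiagonal h1.of_norm, F2,
    h2.of_norm.tsum_prod' fun m => (hasSum_F2term_right a c b₁ b₂ hb x hz m).summable,
    ← tsum_mul_left]
  refine tsum_congr fun m => ?_
  rw [(hasSum_F2term_right a c b₁ b₂ hb x hz m).tsum_eq, sub_sub_cancel, Finset.mul_sum,
    Finset.mul_sum]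
  refine Finset.sum_congr rfl fun p hp => ?_
  obtain rfl := Finset.HasAntidiagonal.mem_antidiagonal.mp hp
  rw [neg_add, Complex.cpow_add _ _ htC, Complex.cpow_neg _ (p.2 : ℂ), Complex.cpow_natCast,
    multichoose_eq_poch_div, multichoose_eq_poch_div, F1term]
  have hpow : (x : ℂ) ^ (p.1 + p.2) * (((x : ℂ) / y) ^ p.2)⁻¹ = x ^ p.1 * y ^ p.2 := by
    rw [pow_add, div_pow]
    field_simp
  linear_combination -(poch a (p.1 + p.2) / poch c (p.1 + p.2) * (poch b₁ p.1 / p.1.factorial) *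
    (poch b₂ p.2 / p.2.factorial)) * (hpow + x ^ (p.1 + p.2) * (((x : ℂ) / y) ^ p.2)⁻¹ * hinv)
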